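/- Step (3) of the virial derivation: assume the Hamiltonian constraint Δψ = −2π ψ⁵ ρ_H − (ψ⁵/8) K̂_i^j K̂_j^i and the slicing equation Δχ = 2π χ ψ⁴ (ρ_H + 2S) + (7/8) χ ψ⁴ K̂_i^j K̂_j^i, where S := j_k (v^k + β^k)/α + 3P, with ρ_H, j, P, v smooth and compactly supported. Assume the flux of the vector field (x·∇ψ) ∇χ + (x·∇χ) ∇ψ − (∇ψ·∇χ) x vanishes at infinity and all displayed integrands are integrable. Then ∫ x^k [ ρ_H ψ⁵ ∂_k χ − (ρ_H + 2S) χ ψ⁴ ∂_k ψ ] dV = −∫ [ (1/2π) ∇χ·∇ψ + (ψ¹² K̂_i^j K̂_j^i / 16π) x^k ∂_k( α ψ^{−6} ) ] dV. -/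

import Mathlib

noncomputable section
open MeasureTheory Filter Topology Real

abbrev E3 := EuclideanSpace ℝ (Fin 3)

/-- Partial derivative in the `i`-th coordinate direction. -/
noncomputable def pd (i : Fin 3) (f : E3 → ℝ) (x : E3) : ℝ :=
  fderiv ℝ f x (EuclideanSpace.single i 1)

/-- Flat Laplacian on `ℝ³`. -/
noncomputable def lap (f : E3 → ℝ) (x : E3) : ℝ := ∑ i, pd i (fun y => pd i f y) x

/-- Surface integral over the sphere of radius `r` (centered at the origin) of the outward
normal component of the vector field with components `F · i`. -/
noncomputable def flux (F : E3 → Fin 3 → ℝ) (r : ℝ) : ℝ :=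
  r ^ 2 * ∫ ω : Metric.sphere (0 : E3) 1,
      (∑ i, F (r • (ω : E3)) i * (ω : E3) i) ∂((volume : Measure E3).toSphere)

/-- Tracefree extrinsic curvature `K̂_i^j` built from lapse `a` and shift `β`. -/
noncomputable def Khat (a : E3 → ℝ) (β : E3 → Fin 3 → ℝ) (i j : Fin 3) (x : E3) : ℝ :=
  (1 / (2 * a x)) *
    (pd i (fun y => β y j) x + pd j (fun y => β y i) x
      - (2 / 3) * (if i = j then (1 : ℝ) else 0) * ∑ k, pd k (fun y => β y k) x)

/-- Double contraction `K̂_i^j K̂_j^i`. -/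
noncomputable def KK (a : E3 → ℝ) (β : E3 → Fin 3 → ℝ) (x : E3) : ℝ :=
  ∑ i, ∑ j, Khat a β i j x * Khat a β j i x
/-- `χ := αψ`. -/
noncomputable def chi (α ψ : E3 → ℝ) (x : E3) : ℝ := α x * ψ x

/-- Polar coordinates. -/
lemma polar_integral (f : E3 → ℝ) (hf : Integrable f) :
    ∫ x, f x = ∫ r in Set.Ioi (0:ℝ), r ^ 2 *
      ∫ ω : Metric.sphere (0 : E3) 1, f (r • (ω : E3)) ∂((volume : Measure E3).toSphere) := by
  have hmp := (volume : Measure E3).measurePreserving_homeomorphUnitSphereProd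
  have hemb := (homeomorphUnitSphereProd E3).measurableEmbedding
  have hdim : Module.finrank ℝ E3 - 1 = 2 := by simp
  rw [hdim] at hmp
  set g : Metric.sphere (0 : E3) 1 × Set.Ioi (0:ℝ) → ℝ := fun p => f (p.2.1 • (p.1 : E3)) with hg
  have hcomp : ∀ x : ({0}ᶜ : Set E3), g (homeomorphUnitSphereProd E3 x) = f x := by
    intro x
    have := (homeomorphUnitSphereProd E3).symm_apply_apply x
    have h2 := congrArg Subtype.val this
    rw [homeomorphUnitSphereProd_symm_apply_coe] at h2
    simp only [hg]
    rw [h2]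
  have h1 : ∫ x, f x = ∫ x : ({0}ᶜ : Set E3), f x.1 ∂(Measure.comap Subtype.val (volume : Measure E3)) := by
    rw [integral_subtype_comap (measurableSet_singleton _).compl f, restrict_compl_singleton]
  have hgi : Integrable g ((volume : Measure E3).toSphere.prod (.volumeIoiPow 2)) := by
    rw [← hmp.integrable_comp_emb hemb]
    have : g ∘ homeomorphUnitSphereProd E3 = f ∘ Subtype.val := by
      funext x; exact hcomp x
    rw [this, ← integrableOn_iff_comap_subtypeVal (measurableSet_singleton _).compl]
    exact hf.integrableOn
  have h2 : ∫ x : ({0}ᶜ : Set E3), f x.1 ∂(Measure.comap Subtype.val (volume : Measure E3))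
      = ∫ p, g p ∂((volume : Measure E3).toSphere.prod (.volumeIoiPow 2)) := by
    rw [← hmp.integral_comp hemb]
    exact integral_congr_ae (.of_forall fun x => (hcomp x).symm)
  rw [h1, h2, integral_prod_symm _ hgi]
  rw [Measure.volumeIoiPow, integral_withDensity_eq_integral_toReal_smul (by fun_prop) (by simp),
    ← integral_subtype_comap measurableSet_Ioi (fun r : ℝ => r ^ 2 *
      ∫ ω : Metric.sphere (0 : E3) 1, f (r • (ω : E3)) ∂((volume : Measure E3).toSphere))]
  refine integral_congr_ae (.of_forall fun r => ?_)
  simp only [smul_eq_mul, hg]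
  rw [ENNReal.toReal_ofReal (by positivity)]

lemma st_deriv_zero_left {t : ℝ} (ht : t ≤ 0) : deriv smoothTransition t = 0 := by
  apply IsLocalMin.deriv_eq_zero
  refine .of_forall fun y => ?_
  rw [smoothTransition.zero_of_nonpos ht]
  exact smoothTransition.nonneg y

lemma st_deriv_zero_right {t : ℝ} (ht : 1 ≤ t) : deriv smoothTransition t = 0 := by
  apply IsLocalMax.deriv_eq_zero
  refine .of_forall fun y => ?_
  rw [smoothTransition.one_of_one_le ht]
  exact smoothTransition.le_one y

lemma st_deriv_cont : Continuous (deriv smoothTransition) :=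
  (smoothTransition.contDiff (n := 1)).continuous_deriv le_rfl

lemma st_deriv_bound : ∃ M : ℝ, 0 < M ∧ ∀ t, |deriv smoothTransition t| ≤ M := by
  obtain ⟨C, hC⟩ := (isCompact_Icc (a := (0:ℝ)) (b := 1)).exists_bound_of_continuousOn
    st_deriv_cont.continuousOn
  refine ⟨max C 1, by positivity, fun t => ?_⟩
  by_cases h0 : t ≤ 0
  · rw [st_deriv_zero_left h0]; simp
  by_cases h1 : 1 ≤ t
  · rw [st_deriv_zero_right h1]; simp
  · exact (hC t ⟨by linarith, by linarith⟩).trans (le_max_left _ _)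

/-- The cutoff function. -/
def cut (R : ℝ) (x : E3) : ℝ := smoothTransition (2 - ‖x‖ ^ 2 / R ^ 2)

lemma cut_contDiff (R : ℝ) : ContDiff ℝ 1 (cut R) := by
  unfold cut
  refine (smoothTransition.contDiff (n := 1)).comp ?_
  exact contDiff_const.sub ((contDiff_norm_sq ℝ).div_const _)

lemma cut_compact {R : ℝ} (hR : 0 < R) : HasCompactSupport (cut R) := by
  refine HasCompactSupport.intro (isCompact_closedBall (0 : E3) (2 * R)) fun x hx => ?_
  have hx' : 2 * R < ‖x‖ := by simpa using hx
  apply smoothTransition.zero_of_nonpos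
  have : 2 ≤ ‖x‖ ^ 2 / R ^ 2 := by
    rw [le_div_iff₀ (by positivity)]
    nlinarith
  linarith

lemma pd_cut (R : ℝ) (k : Fin 3) (x : E3) :
    pd k (cut R) x = - (deriv smoothTransition (2 - ‖x‖ ^ 2 / R ^ 2) * (2 * x k / R ^ 2)) := by
  have h1 : HasFDerivAt (fun y : E3 => 2 - ‖y‖ ^ 2 / R ^ 2)
      (-((R ^ 2)⁻¹ • (2 • innerSL ℝ x))) x := by
    have := ((hasStrictFDerivAt_norm_sq x).hasFDerivAt.mul_const (R ^ 2)⁻¹).const_sub 2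
    simpa [div_eq_mul_inv] using this
  have h2 : HasDerivAt smoothTransition (deriv smoothTransition (2 - ‖x‖ ^ 2 / R ^ 2))
      (2 - ‖x‖ ^ 2 / R ^ 2) :=
    (((smoothTransition.contDiff (n := 1)).differentiable (by simp)) _).hasDerivAt
  have h3 := h2.comp_hasFDerivAt x h1
  unfold pd
  have h4 : fderiv ℝ (cut R) x = _ := h3.fderiv
  rw [h4]
  have h5 : inner ℝ x (EuclideanSpace.single k (1:ℝ)) = x k := by
    simp [EuclideanSpace.inner_single_right]
  simp only [smul_apply, neg_apply, innerSL_apply_apply, h5,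
    smul_eq_mul, nsmul_eq_mul]
  push_cast
  ring

lemma pd_continuous {f : E3 → ℝ} (hf : ContDiff ℝ 1 f) (k : Fin 3) : Continuous (pd k f) := by
  unfold pd
  exact (hf.continuous_fderiv (by simp)).clm_apply continuous_const

/-- Cutoff version of the divergence theorem. -/
lemma cut_div (F : E3 → Fin 3 → ℝ) (hF : ∀ k, ContDiff ℝ 1 (fun x => F x k)) {R : ℝ} (hR : 0 < R) :
    ∫ x, cut R x * ∑ k, pd k (fun y => F y k) x
      = ∫ r in Set.Ioi (0:ℝ), deriv smoothTransition (2 - r ^ 2 / R ^ 2) * (2 * r / R ^ 2)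
          * flux F r := by
  have hc := cut_contDiff R
  have hs := cut_compact hR
  have hi1 : ∀ k, Integrable (fun x => cut R x * pd k (fun y => F y k) x) := fun k =>
    (hc.continuous.mul (pd_continuous (hF k) k)).integrable_of_hasCompactSupport hs.mul_right
  have hpds : ∀ k, HasCompactSupport (pd k (cut R)) := fun k => hs.fderiv_apply (𝕜 := ℝ) _
  have hi2 : ∀ k, Integrable (fun x => pd k (cut R) x * F x k) := fun k =>
    ((pd_continuous hc k).mul (hF k).continuous).integrable_of_hasCompactSupport
      (hpds k).mul_right
  have hi3 : ∀ k, Integrable (fun x => cut R x * F x k) := fun k =>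
    (hc.continuous.mul (hF k).continuous).integrable_of_hasCompactSupport hs.mul_right
  have hip : ∀ k, ∫ x, cut R x * pd k (fun y => F y k) x = - ∫ x, pd k (cut R) x * F x k :=
    fun k => integral_mul_fderiv_eq_neg_fderiv_mul_of_integrable (hi2 k) (hi1 k) (hi3 k)
      (fun x _ => hc.differentiable (by simp) x) (fun x _ => (hF k).differentiable (by simp) x)
  simp only [Finset.mul_sum]
  rw [integral_finsetSum _ (fun k _ => hi1 k)]
  simp only [hip]
  rw [Finset.sum_neg_distrib, ← integral_finsetSum _ (fun k _ => hi2 k), ← integral_neg,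
    polar_integral (fun a => -∑ i, pd i (cut R) a * F a i)
      (integrable_finsetSum _ (fun k _ => hi2 k)).neg]
  refine setIntegral_congr_fun measurableSet_Ioi fun r hr => ?_
  have hr' : 0 < r := hr
  simp only [flux]
  suffices h : ∫ ω : Metric.sphere (0 : E3) 1,
        -∑ i, pd i (cut R) (r • (ω : E3)) * F (r • (ω : E3)) i ∂((volume : Measure E3).toSphere)
      = (deriv smoothTransition (2 - r ^ 2 / R ^ 2) * (2 * r / R ^ 2)) *
        ∫ ω : Metric.sphere (0 : E3) 1,
          (∑ i, F (r • (ω : E3)) i * (ω : E3) i) ∂((volume : Measure E3).toSphere) by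
    rw [h]; ring
  rw [← integral_const_mul]
  refine integral_congr_ae (.of_forall fun ω => ?_)
  have hω : ‖r • (ω : E3)‖ = r := by
    have h1 : ‖(ω : E3)‖ = 1 := by simpa using ω.2
    have h2 : ‖r • (ω : E3)‖ = ‖r‖ * ‖(ω : E3)‖ := norm_smul r (ω : E3)
    rw [h2, h1, Real.norm_of_nonneg hr'.le, mul_one]
  simp only [pd_cut, hω, Finset.mul_sum, ← Finset.sum_neg_distrib]
  refine Finset.sum_congr rfl fun k _ => ?_
  simp
  ring

/-- Divergence theorem on the whole space with vanishing flux. -/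
lemma integral_div_zero (F : E3 → Fin 3 → ℝ) (hF : ∀ k, ContDiff ℝ 1 (fun x => F x k))
    (hflux : Tendsto (flux F) atTop (𝓝 0))
    (hint : Integrable fun x => ∑ k, pd k (fun y => F y k) x) :
    ∫ x, ∑ k, pd k (fun y => F y k) x = 0 := by
  have hA : Tendsto (fun R : ℝ => ∫ x, cut R x * ∑ k, pd k (fun y => F y k) x) atTop
      (𝓝 (∫ x, ∑ k, pd k (fun y => F y k) x)) := by
    refine tendsto_integral_filter_of_dominated_convergence
      (fun x => ‖∑ k, pd k (fun y => F y k) x‖) ?_ ?_ hint.norm ?_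
    · exact .of_forall fun R =>
        (cut_contDiff R).continuous.aestronglyMeasurable.mul hint.aestronglyMeasurable
    · refine .of_forall fun R => .of_forall fun x => ?_
      rw [norm_mul]
      refine mul_le_of_le_one_left (norm_nonneg _) ?_
      unfold cut
      rw [Real.norm_of_nonneg (smoothTransition.nonneg _)]
      exact smoothTransition.le_one _
    · refine .of_forall fun x => ?_
      refine tendsto_const_nhds.congr' ?_
      filter_upwards [eventually_gt_atTop (0:ℝ), eventually_ge_atTop ‖x‖] with R h0 hR
      have : cut R x = 1 := by
        apply smoothTransition.one_of_one_le
        have : ‖x‖ ^ 2 / R ^ 2 ≤ 1 := by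
          rw [div_le_one (by positivity)]
          gcongr
        linarith
      rw [this, one_mul]
  have hB : Tendsto (fun R : ℝ => ∫ x, cut R x * ∑ k, pd k (fun y => F y k) x) atTop (𝓝 0) := by
    obtain ⟨M, hM, hMb⟩ := st_deriv_bound
    rw [Metric.tendsto_nhds]
    intro ε hε
    have hδ : 0 < ε / (8 * M) := by positivity
    have h1 := (Metric.tendsto_nhds.1 hflux) _ hδ
    obtain ⟨R0, hR0⟩ := eventually_atTop.1 h1
    filter_upwards [eventually_gt_atTop (0:ℝ), eventually_ge_atTop R0] with R h0 hR
    rw [cut_div F hF h0, dist_zero_right]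
    rw [setIntegral_eq_of_subset_of_forall_sdiff_eq_zero (s := Set.Ioc R (2 * R))
      measurableSet_Ioi (fun r hr => h0.trans hr.1)]
    · have := norm_setIntegral_le_of_norm_le_const (μ := volume) (s := Set.Ioc R (2 * R))
        (f := fun r => deriv smoothTransition (2 - r ^ 2 / R ^ 2) * (2 * r / R ^ 2) * flux F r)
        (C := M * (4 / R) * (ε / (8 * M))) (by simp) ?_
      · refine this.trans_lt ?_
        have hv : volume.real (Set.Ioc R (2 * R)) = R := by
          rw [Real.volume_real_Ioc_of_le (by linarith)]; ring
        rw [hv]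
        have : M * (4 / R) * (ε / (8 * M)) * R = ε / 2 := by
          field_simp; norm_num
        rw [this]; linarith
      · intro r hr
        have hr0 : 0 < r := h0.trans hr.1
        rw [norm_mul, norm_mul]
        have hf := hR0 r (hR.trans hr.1.le)
        rw [dist_zero_right] at hf
        have h2 : ‖2 * r / R ^ 2‖ ≤ 4 / R := by
          rw [Real.norm_of_nonneg (by positivity), div_le_div_iff₀ (by positivity) h0]
          have := hr.2
          nlinarith [mul_le_mul_of_nonneg_left this h0.le]
        gcongr
        exact hMb _
    · intro r hr
      have hr0 : 0 < r := hr.1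
      have : deriv smoothTransition (2 - r ^ 2 / R ^ 2) = 0 := by
        by_cases h : r ≤ R
        · apply st_deriv_zero_right
          have : r ^ 2 / R ^ 2 ≤ 1 := by
            rw [div_le_one (by positivity)]
            gcongr
          linarith
        · apply st_deriv_zero_left
          have h3 : 2 * R < r := by
            by_contra h4
            exact hr.2 ⟨not_le.1 h, not_lt.1 h4⟩
          have : 2 ≤ r ^ 2 / R ^ 2 := by
            rw [le_div_iff₀ (by positivity)]
            nlinarith
          linarith
      rw [this]; ring
  exact tendsto_nhds_unique hA hB

lemma pd_add {f g : E3 → ℝ} {x : E3} (k : Fin 3) (hf : DifferentiableAt ℝ f x)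
    (hg : DifferentiableAt ℝ g x) : pd k (fun y => f y + g y) x = pd k f x + pd k g x := by
  unfold pd; rw [fderiv_fun_add hf hg]; simp

lemma pd_sub {f g : E3 → ℝ} {x : E3} (k : Fin 3) (hf : DifferentiableAt ℝ f x)
    (hg : DifferentiableAt ℝ g x) : pd k (fun y => f y - g y) x = pd k f x - pd k g x := by
  unfold pd; rw [fderiv_fun_sub hf hg]; simp

lemma pd_mul {f g : E3 → ℝ} {x : E3} (k : Fin 3) (hf : DifferentiableAt ℝ f x)
    (hg : DifferentiableAt ℝ g x) :
    pd k (fun y => f y * g y) x = pd k f x * g x + f x * pd k g x := by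
  unfold pd; rw [fderiv_fun_mul hf hg]; simp; ring

lemma pd_sum {f : Fin 3 → E3 → ℝ} {x : E3} (k : Fin 3) (hf : ∀ i, DifferentiableAt ℝ (f i) x) :
    pd k (fun y => ∑ i, f i y) x = ∑ i, pd k (f i) x := by
  unfold pd; rw [fderiv_fun_sum (fun i _ => hf i)]; simp

lemma pd_coord (k i : Fin 3) (x : E3) : pd k (fun y : E3 => y i) x = if i = k then 1 else 0 := by
  have : HasFDerivAt (fun y : E3 => y i) (EuclideanSpace.proj i : E3 →L[ℝ] ℝ) x :=
    (EuclideanSpace.proj i : E3 →L[ℝ] ℝ).hasFDerivAt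
  unfold pd; rw [this.fderiv]; simp

lemma pd_contDiff {f : E3 → ℝ} (hf : ContDiff ℝ (⊤ : ℕ∞) f) (k : Fin 3) :
    ContDiff ℝ (⊤ : ℕ∞) (pd k f) := by
  unfold pd
  exact (hf.fderiv_right (m := (⊤ : ℕ∞)) (by simp)).clm_apply contDiff_const

lemma pd_comm {f : E3 → ℝ} (hf : ContDiff ℝ (⊤ : ℕ∞) f) (k i : Fin 3) (x : E3) :
    pd k (pd i f) x = pd i (pd k f) x := by
  have hd : DifferentiableAt ℝ (fderiv ℝ f) x :=
    ((hf.fderiv_right (m := (⊤ : ℕ∞)) (by simp)).differentiable (by simp)) x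
  have hs : IsSymmSndFDerivAt ℝ f x := (hf.contDiffAt).isSymmSndFDerivAt (by
    simp only [minSmoothness_of_isRCLikeNormedField]; exact WithTop.coe_le_coe.2 (le_top : (2:ℕ∞) ≤ ⊤))
  have key : ∀ a b : Fin 3, pd a (pd b f) x
      = fderiv ℝ (fderiv ℝ f) x (EuclideanSpace.single a 1) (EuclideanSpace.single b 1) := by
    intro a b
    unfold pd
    rw [fderiv_clm_apply hd (by fun_prop)]
    simp
  rw [key, key]
  exact hs _ _

/-- The pointwise divergence identity. -/
lemma div_identity {f g : E3 → ℝ} (hf : ContDiff ℝ (⊤ : ℕ∞) f) (hg : ContDiff ℝ (⊤ : ℕ∞) g)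
    (x : E3) :
    ∑ k, pd k (fun y =>
        (∑ i, y i * pd i f y) * pd k g y + (∑ i, y i * pd i g y) * pd k f y
          - (∑ i, pd i f y * pd i g y) * y k) x
      = (∑ i, x i * pd i f x) * lap g x + (∑ i, x i * pd i g x) * lap f x
        - ∑ i, pd i g x * pd i f x := by
  have df : ∀ i, DifferentiableAt ℝ (pd i f) x := fun i =>
    (pd_contDiff hf i).differentiable (by simp) x
  have dg : ∀ i, DifferentiableAt ℝ (pd i g) x := fun i =>
    (pd_contDiff hg i).differentiable (by simp) x
  have dx : ∀ i, DifferentiableAt ℝ (fun y : E3 => y i) x := fun i => by fun_prop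
  have dxf : ∀ i, DifferentiableAt ℝ (fun y : E3 => y i * pd i f y) x := fun i => (dx i).mul (df i)
  have dxg : ∀ i, DifferentiableAt ℝ (fun y : E3 => y i * pd i g y) x := fun i => (dx i).mul (dg i)
  have dfg : ∀ i, DifferentiableAt ℝ (fun y : E3 => pd i f y * pd i g y) x :=
    fun i => (df i).mul (dg i)
  have sxf : DifferentiableAt ℝ (fun y : E3 => ∑ i, y i * pd i f y) x :=
    DifferentiableAt.fun_sum fun i _ => dxf i
  have sxg : DifferentiableAt ℝ (fun y : E3 => ∑ i, y i * pd i g y) x :=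
    DifferentiableAt.fun_sum fun i _ => dxg i
  have sfg : DifferentiableAt ℝ (fun y : E3 => ∑ i, pd i f y * pd i g y) x :=
    DifferentiableAt.fun_sum fun i _ => dfg i
  have step : ∀ k, pd k (fun y =>
        (∑ i, y i * pd i f y) * pd k g y + (∑ i, y i * pd i g y) * pd k f y
          - (∑ i, pd i f y * pd i g y) * y k) x
      = ((∑ i, ((if i = k then 1 else 0) * pd i f x + x i * pd k (pd i f) x)) * pd k g x
          + (∑ i, x i * pd i f x) * pd k (pd k g) x)
        + ((∑ i, ((if i = k then 1 else 0) * pd i g x + x i * pd k (pd i g) x)) * pd k f x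
          + (∑ i, x i * pd i g x) * pd k (pd k f) x)
        - ((∑ i, (pd k (pd i f) x * pd i g x + pd i f x * pd k (pd i g) x)) * x k
          + (∑ i, pd i f x * pd i g x) * 1) := by
    intro k
    rw [pd_sub k ((sxf.fun_mul (dg k)).fun_add (sxg.fun_mul (df k))) (sfg.fun_mul (dx k)),
      pd_add k (sxf.fun_mul (dg k)) (sxg.fun_mul (df k)), pd_mul k sxf (dg k), pd_mul k sxg (df k),
      pd_mul k sfg (dx k), pd_sum k dxf, pd_sum k dxg, pd_sum k dfg, pd_coord k k]
    simp only [pd_mul k (dx _) (df _), pd_mul k (dx _) (dg _), pd_mul k (df _) (dg _), pd_coord,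
      if_true]
  simp only [step, lap]
  have c1 := pd_comm hf 1 0 x
  have c2 := pd_comm hf 2 0 x
  have c3 := pd_comm hf 2 1 x
  have d1 := pd_comm hg 1 0 x
  have d2 := pd_comm hg 2 0 x
  have d3 := pd_comm hg 2 1 x
  simp [Fin.sum_univ_three, c1, c2, c3, d1, d2, d3]
  ring

lemma pd_quot {α ψ : E3 → ℝ} (hψ : ∀ x, 0 < ψ x) (hα : ContDiff ℝ (⊤ : ℕ∞) α)
    (hψC : ContDiff ℝ (⊤ : ℕ∞) ψ) (k : Fin 3) (x : E3) :
    ψ x ^ 12 * pd k (fun y => α y / ψ y ^ 6) x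
      = ψ x ^ 5 * pd k (chi α ψ) x - 7 * chi α ψ x * ψ x ^ 4 * pd k ψ x := by
  have da : DifferentiableAt ℝ α x := hα.differentiable (by simp) x
  have dp : DifferentiableAt ℝ ψ x := hψC.differentiable (by simp) x
  have dq : DifferentiableAt ℝ (fun y => α y / ψ y ^ 6) x  := by
    have dpi : DifferentiableAt ℝ (fun y => (ψ y ^ 6)⁻¹) x :=
      (dp.fun_pow 6).fun_inv (pow_ne_zero _ (hψ x).ne')
    simpa only [div_eq_mul_inv] using da.fun_mul dpi
  have hpow : pd k (fun y => ψ y ^ 7) x = 7 * ψ x ^ 6 * pd k ψ x := by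
    unfold pd; rw [fderiv_fun_pow 7 dp]; simp
  have hchi : chi α ψ = fun y => (α y / ψ y ^ 6) * ψ y ^ 7 := by
    funext y
    have := (hψ y).ne'
    unfold chi; field_simp
  have h1 : pd k (chi α ψ) x = pd k (fun y => α y / ψ y ^ 6) x * ψ x ^ 7
      + (α x / ψ x ^ 6) * (7 * ψ x ^ 6 * pd k ψ x) := by
    rw [hchi, pd_mul k dq (dp.fun_pow 7)]
    rw [hpow]
  rw [h1]
  have := (hψ x).ne'
  unfold chi
  field_simp
  ring

/-- Step (3) of the virial derivation:
`∫ x^k [ρ_H ψ⁵ ∂_k χ − (ρ_H + 2S) χ ψ⁴ ∂_k ψ] dV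
  = −∫ [(1/2π) ∇χ·∇ψ + (ψ¹² K̂_i^j K̂_j^i / 16π) x^k ∂_k(α ψ⁻⁶)] dV`. -/
theorem virial_step3
    (α ψ : E3 → ℝ) (β j v : E3 → Fin 3 → ℝ) (ρH P : E3 → ℝ)
    (hα : ∀ x, 0 < α x) (hψ : ∀ x, 0 < ψ x)
    (hαC : ContDiff ℝ (⊤ : ℕ∞) α) (hψC : ContDiff ℝ (⊤ : ℕ∞) ψ)
    (hβC : ∀ i, ContDiff ℝ (⊤ : ℕ∞) fun x => β x i)
    (hjC : ∀ i, ContDiff ℝ (⊤ : ℕ∞) fun x => j x i)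
    (hvC : ∀ i, ContDiff ℝ (⊤ : ℕ∞) fun x => v x i)
    (hρHC : ContDiff ℝ (⊤ : ℕ∞) ρH) (hPC : ContDiff ℝ (⊤ : ℕ∞) P)
    (hjsupp : ∀ i, HasCompactSupport fun x => j x i)
    (hvsupp : ∀ i, HasCompactSupport fun x => v x i)
    (hρHsupp : HasCompactSupport ρH) (hPsupp : HasCompactSupport P)
    -- Hamiltonian constraint
    (hham : ∀ x : E3,
      lap ψ x = -(2 * π) * ψ x ^ 5 * ρH x - (ψ x ^ 5 / 8) * KK α β x)
    -- slicing equation, with S = j_k (v^k + β^k)/α + 3P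
    (hslice : ∀ x : E3,
      lap (chi α ψ) x
        = 2 * π * chi α ψ x * ψ x ^ 4
            * (ρH x + 2 * ((∑ k, j x k * (v x k + β x k)) / α x + 3 * P x))
          + (7 / 8) * chi α ψ x * ψ x ^ 4 * KK α β x)
    -- the flux of (x·∇ψ)∇χ + (x·∇χ)∇ψ − (∇ψ·∇χ)x vanishes at infinity
    (hflux : Tendsto (flux fun x k =>
      (∑ i, x i * pd i ψ x) * pd k (chi α ψ) x
        + (∑ i, x i * pd i (chi α ψ) x) * pd k ψ x
        - (∑ i, pd i ψ x * pd i (chi α ψ) x) * x k) atTop (𝓝 0))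
    -- integrability of the displayed integrands
    (hint1 : Integrable fun x : E3 =>
      ∑ k, x k * (ρH x * ψ x ^ 5 * pd k (chi α ψ) x
        - (ρH x + 2 * ((∑ l, j x l * (v x l + β x l)) / α x + 3 * P x))
            * chi α ψ x * ψ x ^ 4 * pd k ψ x))
    (hint2 : Integrable fun x : E3 => ∑ i, pd i (chi α ψ) x * pd i ψ x)
    (hint3 : Integrable fun x : E3 =>
      (ψ x ^ 12 * KK α β x / (16 * π)) * ∑ k, x k * pd k (fun y => α y / ψ y ^ 6) x)
    (hint4 : Integrable fun x : E3 =>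
      (∑ i, x i * pd i ψ x) * lap (chi α ψ) x
        + (∑ i, x i * pd i (chi α ψ) x) * lap ψ x)
    (hint5 : Integrable fun x : E3 =>
      ∑ k, pd k (fun y =>
        (∑ i, y i * pd i ψ y) * pd k (chi α ψ) y
          + (∑ i, y i * pd i (chi α ψ) y) * pd k ψ y
          - (∑ i, pd i ψ y * pd i (chi α ψ) y) * y k) x) :
    (∫ x : E3,
        ∑ k, x k * (ρH x * ψ x ^ 5 * pd k (chi α ψ) x
          - (ρH x + 2 * ((∑ l, j x l * (v x l + β x l)) / α x + 3 * P x))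
              * chi α ψ x * ψ x ^ 4 * pd k ψ x))
      = -∫ x : E3,
          (1 / (2 * π)) * (∑ i, pd i (chi α ψ) x * pd i ψ x)
            + (ψ x ^ 12 * KK α β x / (16 * π))
                * ∑ k, x k * pd k (fun y => α y / ψ y ^ 6) x := by

  have hχC : ContDiff ℝ (⊤ : ℕ∞) (chi α ψ) := hαC.mul hψC
  have hcC : ∀ k, ContDiff ℝ (⊤ : ℕ∞) (fun y : E3 => y k) := fun k => by fun_prop
  have hF : ∀ k, ContDiff ℝ 1 (fun x : E3 =>
      (∑ i, x i * pd i ψ x) * pd k (chi α ψ) x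
        + (∑ i, x i * pd i (chi α ψ) x) * pd k ψ x
        - (∑ i, pd i ψ x * pd i (chi α ψ) x) * x k) := by
    intro k
    have h : ContDiff ℝ (⊤ : ℕ∞) (fun x : E3 =>
      (∑ i, x i * pd i ψ x) * pd k (chi α ψ) x
        + (∑ i, x i * pd i (chi α ψ) x) * pd k ψ x
        - (∑ i, pd i ψ x * pd i (chi α ψ) x) * x k) :=
      (((ContDiff.sum fun i _ => (hcC i).mul (pd_contDiff hψC i)).mul (pd_contDiff hχC k)).add
        ((ContDiff.sum fun i _ => (hcC i).mul (pd_contDiff hχC i)).mul (pd_contDiff hψC k))).sub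
        ((ContDiff.sum fun i _ => (pd_contDiff hψC i).mul (pd_contDiff hχC i)).mul (hcC k))
    exact h.of_le (by exact_mod_cast le_top)
  have hdiv := integral_div_zero _ hF hflux hint5
  rw [← integral_neg]
  have hpt : ∀ x : E3,
      ∑ k, x k * (ρH x * ψ x ^ 5 * pd k (chi α ψ) x
          - (ρH x + 2 * ((∑ l, j x l * (v x l + β x l)) / α x + 3 * P x))
              * chi α ψ x * ψ x ^ 4 * pd k ψ x)
      = -((1 / (2 * π)) * (∑ i, pd i (chi α ψ) x * pd i ψ x)
            + (ψ x ^ 12 * KK α β x / (16 * π))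
                * ∑ k, x k * pd k (fun y => α y / ψ y ^ 6) x)
        - (1 / (2 * π)) * ∑ k, pd k (fun y =>
        (∑ i, y i * pd i ψ y) * pd k (chi α ψ) y
          + (∑ i, y i * pd i (chi α ψ) y) * pd k ψ y
          - (∑ i, pd i ψ y * pd i (chi α ψ) y) * y k) x := by
    intro x
    rw [div_identity hψC hχC x, hham x, hslice x]
    have hq : (ψ x ^ 12 * KK α β x / (16 * π)) * ∑ k, x k * pd k (fun y => α y / ψ y ^ 6) x
        = (KK α β x / (16 * π)) * ∑ k, x k *
          (ψ x ^ 5 * pd k (chi α ψ) x - 7 * chi α ψ x * ψ x ^ 4 * pd k ψ x) := by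
      simp only [← pd_quot hψ hαC hψC, Finset.mul_sum]
      exact Finset.sum_congr rfl fun k _ => by ring
    rw [hq]
    generalize (∑ l, j x l * (v x l + β x l)) / α x = s
    have hpi := Real.pi_ne_zero
    simp only [Fin.sum_univ_three]
    field_simp
    ring
  rw [integral_congr_ae (.of_forall hpt)]
  have hneg : Integrable fun x : E3 => -((1 / (2 * π)) * (∑ i, pd i (chi α ψ) x * pd i ψ x)
            + (ψ x ^ 12 * KK α β x / (16 * π))
                * ∑ k, x k * pd k (fun y => α y / ψ y ^ 6) x) :=
    ((hint2.const_mul _).add hint3).neg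
  rw [integral_sub hneg (hint5.const_mul _), integral_const_mul,
    hdiv, mul_zero, sub_zero]
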